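/- Fix an integer N ≥ 2 and let σ : ℝ^N × (0,∞)^{N−1} → ℝ^N_> × S_N be the spectral map sending (a,b) to (x, w), where x_1 > … > x_N are the eigenvalues of the Jacobi matrix J_{a,b} and w_n = (u_n)_1² is the squared first coordinate of a unit eigenvector u_n of J_{a,b} associated with x_n. Then σ is a C¹-diffeomorphism from ℝ^N × (0,∞)^{N−1} onto ℝ^N_> × S_N, and at every point (a,b) the absolute value of the determinant of its derivative (as a linear map ℝ^{2N−1} → ℝ^{2N−1}) equals ∏_{n=1}^{N−1} b_n^{−1} · ∏_{n=1}^N w_n, where (x,w) = σ(a,b) and w_N = 1 − Σ_{n=1}^{N−1} w_n. -/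

import Mathlib

open MeasureTheory ProbabilityTheory Matrix Finset Real
open scoped ENNReal NNReal

noncomputable section

/-- The symmetric tridiagonal (Jacobi) matrix with diagonal `a` and
off-diagonal entries `√(b n)`. -/
def jacobiMatrix {N : ℕ} (a : Fin N → ℝ) (b : Fin (N - 1) → ℝ) :
    Matrix (Fin N) (Fin N) ℝ :=
  Matrix.of fun i j =>
    if i = j then a i
    else if h : (i : ℕ) + 1 = (j : ℕ) then
      Real.sqrt (b ⟨i, by have := j.isLt; omega⟩)
    else if h' : (j : ℕ) + 1 = (i : ℕ) then
      Real.sqrt (b ⟨j, by have := i.isLt; omega⟩)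
    else 0

lemma jacobiMatrix_isHermitian {N : ℕ} (a : Fin N → ℝ) (b : Fin (N - 1) → ℝ) :
    (jacobiMatrix a b).IsHermitian := by
  unfold Matrix.IsHermitian
  ext i j
  simp only [jacobiMatrix, Matrix.conjTranspose_apply, Matrix.of_apply, star_trivial]
  by_cases hij : i = j
  · subst hij; simp
  · have hji : j ≠ i := fun h => hij h.symm
    rw [if_neg hji, if_neg hij]
    by_cases h1 : (j : ℕ) + 1 = (i : ℕ)
    · have h2 : ¬((i : ℕ) + 1 = (j : ℕ)) := by omega
      rw [dif_pos h1, dif_neg h2, dif_pos h1]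
    · by_cases h2 : (i : ℕ) + 1 = (j : ℕ)
      · rw [dif_neg h1, dif_pos h2, dif_pos h2]
      · rw [dif_neg h1, dif_neg h2, dif_neg h2, dif_neg h1]

/-- Reordering of a finite tuple in decreasing order. -/
def sortDesc {N : ℕ} (v : Fin N → ℝ) : Fin N → ℝ :=
  fun i => v (Tuple.sort v (Fin.rev i))

/-- The eigenvalues of the Jacobi matrix `J_{a,b}`, in decreasing order. -/
def jacobiEigs {N : ℕ} (a : Fin N → ℝ) (b : Fin (N - 1) → ℝ) : Fin N → ℝ :=
  sortDesc (jacobiMatrix_isHermitian a b).eigenvalues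

/-- The squared first coordinates of unit eigenvectors of the Jacobi matrix `J_{a,b}`,
indexed compatibly with `jacobiEigs` (decreasing eigenvalue order):
`jacobiWeights hN a b i` is the squared first coordinate of a unit eigenvector
associated with the eigenvalue `jacobiEigs a b i`. -/
def jacobiWeights {N : ℕ} (hN : 0 < N) (a : Fin N → ℝ) (b : Fin (N - 1) → ℝ) :
    Fin N → ℝ :=
  fun i =>
    ((jacobiMatrix_isHermitian a b).eigenvectorBasis
        (Tuple.sort (jacobiMatrix_isHermitian a b).eigenvalues (Fin.rev i)) ⟨0, hN⟩) ^ 2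

/-- The spectral map: Jacobi data `(a, b)` is sent to the decreasingly ordered
eigenvalues together with the first `N - 1` spectral weights. -/
def spectralMap {N : ℕ} (hN : 0 < N) (a : Fin N → ℝ) (b : Fin (N - 1) → ℝ) :
    (Fin N → ℝ) × (Fin (N - 1) → ℝ) :=
  ⟨jacobiEigs a b, fun i => jacobiWeights hN a b ⟨i, by have := i.isLt; omega⟩⟩

/-- The Vandermonde product `∏_{i<j} (x j - x i)`. -/
def vdm {N : ℕ} (x : Fin N → ℝ) : ℝ :=
  ∏ i : Fin N, ∏ j ∈ Finset.Ioi i, (x j - x i)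

/-- The open chamber of decreasing vectors `x 0 > x 1 > … `. -/
def chamber (N : ℕ) : Set (Fin N → ℝ) := {x | ∀ i j : Fin N, i < j → x j < x i}

/-- The open simplex of positive weights with sum `< 1`. -/
def openSimplex (N : ℕ) : Set (Fin (N - 1) → ℝ) :=
  {w | (∀ i, 0 < w i) ∧ ∑ i, w i < 1}

/-- Extension of `N - 1` weights by the last weight `1 - ∑ w`. -/
def wExt {N : ℕ} (w : Fin (N - 1) → ℝ) : Fin N → ℝ :=
  fun n => if h : (n : ℕ) < N - 1 then w ⟨n, h⟩ else 1 - ∑ i, w i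

/-- The first `N` coordinates of a vector of length `2N - 1`. -/
def xPart {N : ℕ} (p : Fin (2 * N - 1) → ℝ) : Fin N → ℝ :=
  fun i => p ⟨i, by have := i.isLt; omega⟩

/-- The last `N - 1` coordinates of a vector of length `2N - 1`. -/
def wPart {N : ℕ} (p : Fin (2 * N - 1) → ℝ) : Fin (N - 1) → ℝ :=
  fun i => p ⟨N + i, by have := i.isLt; omega⟩

/-- The diagonal coefficients `a` built from the parameters `ξ`:
`a 1 = ξ 1`, `a n = ξ (2n-2) + ξ (2n-1)` (in one-based notation). -/
def xiToA {N : ℕ} (ξ : Fin (2 * N - 1) → ℝ) : Fin N → ℝ :=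
  fun n =>
    if h : (n : ℕ) = 0 then ξ ⟨0, by have := n.isLt; omega⟩
    else ξ ⟨2 * (n : ℕ) - 1, by have := n.isLt; omega⟩ +
      ξ ⟨2 * (n : ℕ), by have := n.isLt; omega⟩

/-- The off-diagonal coefficients `b` built from the parameters `ξ`:
`b n = ξ (2n-1) * ξ (2n)` (in one-based notation). -/
def xiToB {N : ℕ} (ξ : Fin (2 * N - 1) → ℝ) : Fin (N - 1) → ℝ :=
  fun n => ξ ⟨2 * (n : ℕ), by have := n.isLt; omega⟩ *
    ξ ⟨2 * (n : ℕ) + 1, by have := n.isLt; omega⟩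

/-- The chain-sequence parameters `ξ` built from canonical moments `c`:
`ξ 1 = c 1` and `ξ n = (1 - c (n-1)) * c n` (in one-based notation). -/
def cToXi {N : ℕ} (c : Fin (2 * N - 1) → ℝ) : Fin (2 * N - 1) → ℝ :=
  fun k =>
    if (k : ℕ) = 0 then c k
    else (1 - c ⟨(k : ℕ) - 1, by have := k.isLt; omega⟩) * c k

/-- The lower bidiagonal matrix `Ξ` with diagonal `√ξ 1, √ξ 3, …` and
subdiagonal `√ξ 2, √ξ 4, …` (in one-based notation). -/
def bidiag {N : ℕ} (ξ : Fin (2 * N - 1) → ℝ) : Matrix (Fin N) (Fin N) ℝ :=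
  Matrix.of fun i j =>
    if i = j then Real.sqrt (ξ ⟨2 * (i : ℕ), by have := i.isLt; omega⟩)
    else if h : (j : ℕ) + 1 = (i : ℕ) then
      Real.sqrt (ξ ⟨2 * (j : ℕ) + 1, by have := i.isLt; omega⟩)
    else 0

lemma mul_transpose_isHermitian {N : ℕ} (A : Matrix (Fin N) (Fin N) ℝ) :
    (A * Aᵀ).IsHermitian := by
  unfold Matrix.IsHermitian
  ext i j
  simp [Matrix.mul_apply, Matrix.conjTranspose_apply, Matrix.transpose_apply, mul_comm]

/-- The set of rolled-up vectors whose node part is strictly decreasing and whose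
weight part lies in the open simplex. -/
def nodeWeightDom (N : ℕ) : Set (Fin (2 * N - 1) → ℝ) :=
  {p | xPart p ∈ chamber N ∧ wPart p ∈ openSimplex N}

/-- The spectral map, rolled up into a self-map of vectors of length `2N - 1`:
first the `N` ordered eigenvalues, then the first `N - 1` spectral weights. -/
def specRolled (N : ℕ) (hN : 0 < N) (p : Fin (2 * N - 1) → ℝ) :
    Fin (2 * N - 1) → ℝ :=
  fun k =>
    if h : (k : ℕ) < N then jacobiEigs (xPart p) (wPart p) ⟨k, h⟩
    else jacobiWeights hN (xPart p) (wPart p) ⟨(k : ℕ) - N, by have := k.isLt; omega⟩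


/-- path-counting coefficients -/
def Lc (q : ℕ → ℝ) : ℕ → ℕ → ℝ
  | 0, i => if i = 0 then 1 else 0
  | k + 1, 0 => q 0 * Lc q k 0 + q 1 * Lc q k 1
  | k + 1, i + 1 => Lc q k i + q (2 * i + 2) * Lc q k (i + 1) + q (2 * i + 3) * Lc q k (i + 2)

/-- products of the off-diagonal parameters -/
def bet (q : ℕ → ℝ) (k : ℕ) : ℝ := ∏ h ∈ Finset.range k, q (2 * h + 1)

lemma bet_succ (q : ℕ → ℝ) (k : ℕ) : bet q (k + 1) = bet q k * q (2 * k + 1) := by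
  simp [bet, Finset.prod_range_succ]

lemma Lc_zero_of_lt (q : ℕ → ℝ) : ∀ k i, k < i → Lc q k i = 0
  | 0, i, h => by simp [Lc]; omega
  | k + 1, 0, h => by omega
  | k + 1, i + 1, h => by
    rw [Lc, Lc_zero_of_lt q k i (by omega), Lc_zero_of_lt q k (i+1) (by omega),
      Lc_zero_of_lt q k (i+2) (by omega)]; ring

lemma Lc_diag (q : ℕ → ℝ) : ∀ k, Lc q k k = 1
  | 0 => by simp [Lc]
  | k + 1 => by
    rw [Lc, Lc_diag q k, Lc_zero_of_lt q k (k+1) (by omega),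
      Lc_zero_of_lt q k (k+2) (by omega)]; ring

lemma Lc_congr (q q' : ℕ → ℝ) : ∀ k i, (∀ j, j < k + i → q j = q' j) → Lc q k i = Lc q' k i
  | 0, i, h => by simp [Lc]
  | k + 1, 0, h => by
    rw [Lc, Lc, Lc_congr q q' k 0 (fun j hj => h j (by omega)),
      Lc_congr q q' k 1 (fun j hj => h j (by omega)), h 0 (by omega)]
    by_cases hk : k < 1
    · rw [Lc_zero_of_lt q' k 1 hk]; ring
    · rw [h 1 (by omega)]
  | k + 1, i + 1, h => by
    rw [Lc, Lc, Lc_congr q q' k i (fun j hj => h j (by omega)),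
      Lc_congr q q' k (i+1) (fun j hj => h j (by omega)),
      Lc_congr q q' k (i+2) (fun j hj => h j (by omega))]
    by_cases hk : k < i + 1
    · rw [Lc_zero_of_lt q' k (i+1) hk, Lc_zero_of_lt q' k (i+2) (by omega)]; ring
    · rw [h (2*i+2) (by omega)]
      by_cases hk : k < i + 2
      · rw [Lc_zero_of_lt q' k (i+2) (by omega)]; ring
      · rw [h (2*i+3) (by omega)]

lemma Lc_diff (q q' : ℕ → ℝ) (s : ℕ) (hs : ∀ j, j < s → q j = q' j) :
    ∀ k i, k + i = s + 1 → i < k →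
      Lc q' k i - Lc q k i = (q' s - q s) * ∏ h ∈ Finset.Ico i (s / 2), q (2 * h + 1)
  | 0, i, h, h' => by omega
  | k + 1, 0, h, h' => by
    have e0 := Lc_congr q q' k 0 (fun j hj => hs j (by omega))
    rw [Lc, Lc, e0]
    by_cases k0 : k = 0
    · obtain rfl : s = 0 := by omega
      subst k0; simp [Lc]
    by_cases k1 : k = 1
    · obtain rfl : s = 1 := by omega
      subst k1
      rw [hs 0 (by omega)]; simp [Lc_diag]
    have ih := Lc_diff q q' s hs k 1 (by omega) (by omega)
    rw [Finset.prod_eq_prod_Ico_succ_bot (by omega), sub_eq_iff_eq_add.1 ih, hs 0 (by omega),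
        show 2 * 0 + 1 = 1 by ring, hs 1 (by omega)]
    ring
  | k + 1, i + 1, h, h' => by
    have e0 := Lc_congr q q' k i (fun j hj => hs j (by omega))
    have e1 := Lc_congr q q' k (i+1) (fun j hj => hs j (by omega))
    rw [Lc, Lc, e0, e1]
    obtain rfl : s = k + i + 1 := by omega
    by_cases hk : k = i + 1
    · subst hk
      rw [Finset.Ico_eq_empty (by omega), Lc_diag, Lc_zero_of_lt q (i+1) (i+2) (by omega),
        Lc_zero_of_lt q' (i+1) (i+2) (by omega), show i + 1 + i + 1 = 2 * i + 2 by ring]; simp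
    by_cases hk2 : k = i + 2
    · subst hk2
      rw [hs (2*i+2) (by omega), Finset.Ico_eq_empty (by omega), Lc_diag, Lc_diag, show i + 2 + i + 1 = 2 * i + 3 by ring]; simp
    have ih := Lc_diff q q' (k+i+1) hs k (i+2) (by omega) (by omega)
    rw [Finset.prod_eq_prod_Ico_succ_bot (by omega), sub_eq_iff_eq_add.1 ih, hs (2*i+2) (by omega), 
      show 2 * (i+1) + 1 = 2 * i + 3 by ring, hs (2*i+3) (by omega)]
    ring

lemma mom_diff (q q' : ℕ → ℝ) (s : ℕ) (hs : ∀ j, j < s → q j = q' j) :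
    Lc q' (s+1) 0 - Lc q (s+1) 0 = (q' s - q s) * bet q (s / 2) := by
  rw [Lc_diff q q' s hs (s+1) 0 (by omega) (by omega), bet, Finset.range_eq_Ico]

lemma tele (q : ℕ → ℝ) (j k M : ℕ) :
    ∑ i ∈ Finset.range (M+1), (Lc q (j+1) i * Lc q k i - Lc q j i * Lc q (k+1) i) * bet q i
      = bet q (M+1) * (Lc q j (M+1) * Lc q k M - Lc q j M * Lc q k (M+1)) := by
  induction M with
  | zero => simp [Lc, bet]; ring
  | succ M ih =>
    rw [Finset.sum_range_succ, ih, bet_succ q (M+1), Lc, Lc]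
    ring

lemma hank_big (q : ℕ → ℝ) : ∀ j k M, j + k < M →
    ∑ i ∈ Finset.range M, Lc q j i * Lc q k i * bet q i = Lc q (j + k) 0
  | 0, k, M, h => by
    rw [Finset.sum_eq_single 0]
    · simp [Lc, bet]
    · intro b _ hb; simp [Lc, hb]
    · intro h'; simp at h'; omega
  | j + 1, k, M, h => by
    have ih := hank_big q j (k+1) M (by omega)
    obtain ⟨M, rfl⟩ : ∃ M', M = M' + 1 := ⟨M - 1, by omega⟩
    have t := tele q j k M
    rw [Lc_zero_of_lt q j (M+1) (by omega), Lc_zero_of_lt q k (M+1) (by omega)] at t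
    simp only [sub_mul, Finset.sum_sub_distrib] at t
    rw [show j + 1 + k = j + (k+1) by ring, ← ih]
    linarith

lemma hank_small (q : ℕ → ℝ) (j k n : ℕ) (hj : j < n) :
    ∑ i ∈ Finset.range n, Lc q j i * Lc q k i * bet q i = Lc q (j + k) 0 := by
  rw [← hank_big q j k (n + j + k + 1) (by omega)]
  apply Finset.sum_subset
  · intro x; simp; omega
  · intro x _ hx
    simp at hx
    rw [Lc_zero_of_lt q j x (by omega)]; ring

lemma hank_det (q : ℕ → ℝ) (n : ℕ) :
    (Matrix.of fun j k : Fin n => Lc q (j + k : ℕ) 0).det = ∏ k ∈ Finset.range n, bet q k := by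
  have : (Matrix.of fun j k : Fin n => Lc q (j + k : ℕ) 0) =
      (Matrix.of fun j i : Fin n => Lc q j i) * Matrix.diagonal (fun i : Fin n => bet q i) *
        (Matrix.of fun j i : Fin n => Lc q j i)ᵀ := by
    ext j k
    rw [Matrix.mul_apply]
    simp only [Matrix.mul_diagonal, Matrix.transpose_apply, Matrix.of_apply]
    rw [← hank_small q j k n j.2, ← Fin.sum_univ_eq_sum_range (fun i => Lc q j i * Lc q k i * bet q i)]
    exact Finset.sum_congr rfl fun _ _ => by ring
  have hL : (Matrix.of fun j i : Fin n => Lc q j i).det = 1 := by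
    rw [Matrix.det_of_isLowerTriangular]
    · simp [Lc_diag]
    · intro i j hij
      exact Lc_zero_of_lt q _ _ hij
  rw [this, Matrix.det_mul, Matrix.det_mul, Matrix.det_transpose, hL, Matrix.det_diagonal,
    Fin.prod_univ_eq_prod_range (fun i => bet q i)]
  ring

lemma contDiff_Lc {E : Type*} [NormedAddCommGroup E] [NormedSpace ℝ E] (q : E → ℕ → ℝ)
    (hq : ∀ j, ContDiff ℝ 1 (fun p => q p j)) : ∀ k i, ContDiff ℝ 1 (fun p => Lc (q p) k i)
  | 0, i => by simp only [Lc]; exact contDiff_const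
  | k + 1, 0 => by
    simp only [Lc]
    exact ((hq _).mul (contDiff_Lc q hq k 0)).add ((hq _).mul (contDiff_Lc q hq k 1))
  | k + 1, i + 1 => by
    simp only [Lc]
    exact ((contDiff_Lc q hq k i).add ((hq _).mul (contDiff_Lc q hq k (i+1)))).add
      ((hq _).mul (contDiff_Lc q hq k (i+2)))


/-- interleaving of the two blocks of coordinates -/
def ilvFun (N : ℕ) (j : Fin (2 * N - 1)) : Fin (2 * N - 1) :=
  ⟨if (j : ℕ) % 2 = 0 then (j : ℕ) / 2 else N + (j : ℕ) / 2, by have := j.isLt; split_ifs <;> omega⟩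

lemma ilvFun_injective (N : ℕ) : Function.Injective (ilvFun N) := by
  intro i j h
  have hi := i.isLt
  have hj := j.isLt
  simp only [ilvFun, Fin.mk.injEq] at h
  ext
  split_ifs at h <;> omega

/-- interleaving as a permutation -/
def ilv (N : ℕ) : Fin (2 * N - 1) ≃ Fin (2 * N - 1) :=
  Equiv.ofBijective (ilvFun N) (Finite.injective_iff_bijective.1 (ilvFun_injective N))

/-- interleaved sequence of Jacobi parameters -/
def qOf (N : ℕ) (p : Fin (2 * N - 1) → ℝ) : ℕ → ℝ :=
  fun j => if h : j < 2 * N - 1 then p (ilv N ⟨j, h⟩) else 0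

lemma qOf_even (N : ℕ) (p : Fin (2 * N - 1) → ℝ) (k : ℕ) (hk : k < N) :
    qOf N p (2 * k) = xPart p ⟨k, hk⟩ := by
  rw [qOf, dif_pos (by omega), xPart]
  congr 1
  ext
  simp [ilv, ilvFun]

lemma qOf_odd (N : ℕ) (p : Fin (2 * N - 1) → ℝ) (k : ℕ) (hk : k < N - 1) :
    qOf N p (2 * k + 1) = wPart p ⟨k, hk⟩ := by
  rw [qOf, dif_pos (by omega), wPart]
  congr 1
  ext
  simp [ilv, ilvFun, Nat.add_mod]
  omega

lemma qOf_top (N : ℕ) (p : Fin (2 * N - 1) → ℝ) (j : ℕ) (hk : 2 * N - 1 ≤ j) :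
    qOf N p j = 0 := by
  rw [qOf, dif_neg (by omega)]

/-- moments as a function of Jacobi parameters -/
def Fm (N : ℕ) (p : Fin (2 * N - 1) → ℝ) : Fin (2 * N - 1) → ℝ :=
  fun j => Lc (qOf N p) (j + 1 : ℕ) 0

lemma contDiff_Fm (N : ℕ) : ContDiff ℝ 1 (Fm N) := by
  rw [contDiff_pi]
  intro j
  apply contDiff_Lc
  intro j
  unfold qOf
  split_ifs
  · exact contDiff_apply ℝ ℝ _
  · exact contDiff_const

lemma bet_pos (N : ℕ) (p : Fin (2 * N - 1) → ℝ) (hp : ∀ i, 0 < wPart p i) (k : ℕ) (hk : k < N) :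
    0 < bet (qOf N p) k := by
  apply Finset.prod_pos
  intro i hi
  simp at hi
  rw [qOf_odd N p i (by omega)]
  exact hp _

lemma Fm_inj (N : ℕ) : Set.InjOn (Fm N) {p : Fin (2 * N - 1) → ℝ | ∀ i, 0 < wPart p i} := by
  intro p hp p' hp' h
  have key : ∀ s, s < 2 * N - 1 → qOf N p s = qOf N p' s := by
    intro s
    induction s using Nat.strong_induction_on with
    | _ s ih =>
      intro hs
      have := mom_diff (qOf N p) (qOf N p') s (fun j hj => ih j hj (by omega))
      have h2 := congrFun h ⟨s, hs⟩
      simp only [Fm] at h2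
      rw [h2, sub_self] at this
      have h3 := bet_pos N p hp (s / 2) (by omega)
      rcases mul_eq_zero.1 this.symm with h4 | h4
      · linarith
      · linarith
  ext c
  obtain ⟨j, rfl⟩ := (ilv N).surjective c
  have := key j j.2
  simpa [qOf] using this

lemma qOf_line (N : ℕ) (p : Fin (2 * N - 1) → ℝ) (i : Fin (2 * N - 1)) (t : ℝ) (j : ℕ) :
    qOf N (p + t • Pi.single (ilv N i) 1) j = qOf N p j + if j = i then t else 0 := by
  unfold qOf
  split_ifs with h1 h2 h2
  · subst h2; simp
  · have : (ilv N ⟨j, h1⟩) ≠ ilv N i := by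
      intro h; apply h2; have := (ilv N).injective h; rw [← this]
    simp [this]
  · have := i.2; omega
  · simp

lemma Fm_line (N : ℕ) (p : Fin (2 * N - 1) → ℝ) (i j : Fin (2 * N - 1)) (hij : j ≤ i) (t : ℝ) :
    Fm N (p + t • Pi.single (ilv N i) 1) j =
      Fm N p j + t * if i = j then bet (qOf N p) ((j : ℕ) / 2) else 0 := by
  have := mom_diff (qOf N p) (qOf N (p + t • Pi.single (ilv N i) 1)) j (fun k hk => by
    rw [qOf_line, if_neg, add_zero]
    have : (j : ℕ) ≤ i := hij
    omega)
  simp only [Fm]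
  rw [sub_eq_iff_eq_add.1 this, qOf_line]
  by_cases h : i = j
  · subst h; simp; ring
  · have : ¬ (j : ℕ) = i := fun h' => h (Fin.ext h'.symm)
    simp [h, this]

lemma fderiv_line {n m : ℕ} (F : (Fin n → ℝ) → (Fin m → ℝ)) (p v : Fin n → ℝ) (j : Fin m) (c : ℝ)
    (hF : DifferentiableAt ℝ F p) (h : ∀ t : ℝ, F (p + t • v) j = F p j + t * c) :
    fderiv ℝ F p v j = c := by
  have h1 := hF.hasFDerivAt.hasLineDerivAt v
  unfold HasLineDerivAt at h1
  have h2 := (hasDerivAt_pi.1 h1) j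
  have h3 : HasDerivAt (fun t : ℝ => F (p + t • v) j) c 0 := by
    simp_rw [h]
    simpa using ((hasDerivAt_id (0:ℝ)).mul_const c).const_add (F p j)
  exact h2.unique h3

lemma det_Fm (N : ℕ) (p : Fin (2 * N - 1) → ℝ) :
    |LinearMap.det (fderiv ℝ (Fm N) p).toLinearMap| =
      |∏ j ∈ Finset.range (2 * N - 1), bet (qOf N p) (j / 2)| := by
  rw [← LinearMap.det_toMatrix', ← Matrix.abs_det_submatrix_equiv_equiv (Equiv.refl _) (ilv N),
    Matrix.det_of_isLowerTriangular]
  · rw [← Fin.prod_univ_eq_prod_range (fun j => bet (qOf N p) (j / 2))]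
    congr 1
    apply Finset.prod_congr rfl
    intro j _
    simp only [Matrix.submatrix_apply, LinearMap.toMatrix'_apply, Equiv.refl_apply]
    apply fderiv_line
    · exact (contDiff_Fm N).differentiable (by norm_num) p
    · intro t
      simpa using Fm_line N p j j le_rfl t
  · intro i j hij
    simp only [Matrix.submatrix_apply, LinearMap.toMatrix'_apply, Equiv.refl_apply]
    apply fderiv_line
    · exact (contDiff_Fm N).differentiable (by norm_num) p
    · intro t
      have hij : i < j := hij
      have := Fm_line N p j i hij.le t
      rwa [if_neg hij.ne'] at this

lemma Fm_solve (N : ℕ) (hN : 2 ≤ N) (m : ℕ → ℝ) (m0 : m 0 = 1)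
    (hm : ∀ n, n ≤ N → 0 < (Matrix.of fun j k : Fin n => m (j + k : ℕ)).det) :
    ∃ p : Fin (2 * N - 1) → ℝ, (∀ i, 0 < wPart p i) ∧ ∀ j, Fm N p j = m (j + 1 : ℕ) := by
  have key : ∀ s, s ≤ 2 * N - 1 → ∃ q : ℕ → ℝ, (∀ i, i ≤ s → Lc q i 0 = m i) ∧
      ∀ k, 2 * k + 1 < s → 0 < q (2 * k + 1) := by
    intro s
    induction s with
    | zero =>
      intro _
      refine ⟨fun _ => 0, ?_, by intros; omega⟩
      intro i hi
      obtain rfl : i = 0 := by omega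
      simp [Lc, m0]
    | succ s ih =>
      intro hs
      obtain ⟨q, h1, h2⟩ := ih (by omega)
      have hb : 0 < bet q (s / 2) := by
        apply Finset.prod_pos
        intro i hi
        simp at hi
        exact h2 _ (by omega)
      let q' := Function.update q s (q s + (m (s+1) - Lc q (s+1) 0) / bet q (s / 2))
      have hag : ∀ j, j < s → q j = q' j := fun j hj => by
        simp [q', Function.update_of_ne hj.ne]
      have hmom : ∀ i, i ≤ s + 1 → Lc q' i 0 = m i := by
        intro i hi
        rcases Nat.lt_or_ge s i with h | h
        · obtain rfl : i = s + 1 := by omega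
          have := mom_diff q q' s hag
          have e : q' s - q s = (m (s+1) - Lc q (s+1) 0) / bet q (s / 2) := by simp [q']
          rw [e, div_mul_cancel₀ _ hb.ne'] at this
          linarith
        · rw [← Lc_congr q q' i 0 (fun j hj => hag j (by omega))]
          exact h1 i h
      refine ⟨q', hmom, ?_⟩
      intro k hk
      rcases Nat.lt_or_ge (2 * k + 1) s with h | h
      · rw [← hag _ h]; exact h2 k h
      · obtain rfl : s = 2 * k + 1 := by omega
        have hd := hm (k + 2) (by omega)
        have e : (Matrix.of fun j l : Fin (k+2) => m (j + l : ℕ)) =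
            Matrix.of fun j l : Fin (k+2) => Lc q' (j + l : ℕ) 0 := by
          ext j l
          have := j.2
          have := l.2
          simp only [Matrix.of_apply]
          rw [hmom _ (by omega)]
        have hbq : ∀ i ≤ k, 0 < bet q' i := by
          intro i hi
          apply Finset.prod_pos
          intro l hl
          simp at hl
          rw [← hag _ (by omega)]
          exact h2 l (by omega)
        rw [e, hank_det, Finset.prod_range_succ, bet_succ] at hd
        have h5 : 0 < ∏ x ∈ Finset.range (k+1), bet q' x :=
          Finset.prod_pos fun i hi => hbq i (by simp at hi; omega)
        have h6 := pos_of_mul_pos_right hd h5.le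
        exact pos_of_mul_pos_right h6 (hbq k le_rfl).le
  obtain ⟨q, h1, h2⟩ := key (2 * N - 1) le_rfl
  refine ⟨fun c => q ((ilv N).symm c), ?_, ?_⟩
  · intro i
    rw [← qOf_odd N _ i i.2]
    have := i.2
    rw [qOf, dif_pos (by omega)]
    simp only [Equiv.symm_apply_apply]
    exact h2 _ (by omega)
  · intro j
    have := j.2
    rw [← h1 _ (by omega), Fm]
    apply Lc_congr
    intro i hi
    rw [qOf, dif_pos (by omega)]
    simp


/-- confluent Newton polynomials -/
def Qp (y : ℕ → ℝ) (l : ℕ) : Polynomial ℝ :=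
  ∏ m ∈ Finset.range l, (Polynomial.X - Polynomial.C (y (m / 2)))

lemma Qp_monic (y : ℕ → ℝ) (l : ℕ) : (Qp y l).Monic :=
  Polynomial.monic_prod_of_monic _ _ fun _ _ => Polynomial.monic_X_sub_C _

lemma Qp_natDegree (y : ℕ → ℝ) (l : ℕ) : (Qp y l).natDegree = l := by
  rw [Qp, Polynomial.natDegree_prod_of_monic _ _ fun _ _ => Polynomial.monic_X_sub_C _]
  simp

/-- confluent functionals -/
def Lf (y : ℕ → ℝ) (l : ℕ) : Polynomial ℝ →ₗ[ℝ] ℝ :=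
  if l % 2 = 0 then Polynomial.leval (y (l / 2)) - Polynomial.leval (y 0)
  else (Polynomial.leval (y (l / 2))).comp Polynomial.derivative

lemma Lf_one (y : ℕ → ℝ) (l : ℕ) : Lf y l 1 = 0 := by
  unfold Lf
  split_ifs <;> simp [Polynomial.leval]

lemma Qp_eval_zero (y : ℕ → ℝ) (l i : ℕ) (h : 2 * i < l) : (Qp y l).eval (y i) = 0 := by
  rw [Qp, Polynomial.eval_prod]
  apply Finset.prod_eq_zero (i := 2 * i) (by simpa using h)
  simp

lemma Qp_succ (y : ℕ → ℝ) (l : ℕ) : Qp y (l + 1) = Qp y l * (Polynomial.X - Polynomial.C (y (l / 2))) := by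
  rw [Qp, Finset.prod_range_succ, Qp]

lemma Qp_deriv_zero (y : ℕ → ℝ) (l i : ℕ) (h : 2 * i + 1 < l) :
    (Polynomial.derivative (Qp y l)).eval (y i) = 0 := by
  obtain ⟨d, rfl⟩ : ∃ d, l = 2 * i + 2 + d := ⟨l - (2 * i + 2), by omega⟩
  clear h
  induction d with
  | zero =>
    rw [add_zero, Qp_succ, Polynomial.derivative_mul]
    have : (2 * i + 1) / 2 = i := by omega
    simp [this, Qp_eval_zero y (2 * i + 1) i]
  | succ d ih =>
    rw [← add_assoc, Qp_succ, Polynomial.derivative_mul]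
    simp [ih, Qp_eval_zero y (2 * i + 2 + d) i (by omega)]

lemma Lf_Qp_lt (y : ℕ → ℝ) (c l : ℕ) (h : c < l) : Lf y c (Qp y l) = 0 := by
  unfold Lf
  split_ifs with hc
  · simp [Polynomial.leval, Qp_eval_zero y l (c / 2) (by omega), Qp_eval_zero y l 0 (by omega)]
  · simp [Polynomial.leval, Qp_deriv_zero y l (c / 2) (by omega)]

lemma Lf_Qp_diag (y : ℕ → ℝ) (l : ℕ) (hl : 0 < l) :
    Lf y l (Qp y l) = (Qp y (2 * (l / 2))).eval (y (l / 2)) := by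
  unfold Lf
  split_ifs with hc
  · have : 2 * (l / 2) = l := by omega
    simp [Polynomial.leval, this, Qp_eval_zero y l 0 hl]
  · have : l = 2 * (l / 2) + 1 := by omega
    generalize l / 2 = i at *
    subst this
    rw [Qp_succ]
    have : 2 * i / 2 = i := by omega
    simp [Polynomial.leval, Polynomial.derivative_mul, this]

lemma det_confl (y : ℕ → ℝ) (n : ℕ) :
    (Matrix.of fun c j : Fin n => Lf y (c + 1 : ℕ) (Polynomial.X ^ (j + 1 : ℕ))).det =
      ∏ c ∈ Finset.range n, (Qp y (2 * ((c + 1) / 2))).eval (y ((c + 1) / 2)) := by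
  set A := (Matrix.of fun c j : Fin n => Lf y (c + 1 : ℕ) (Polynomial.X ^ (j + 1 : ℕ))) with hA
  let C : Matrix (Fin n) (Fin n) ℝ := Matrix.of fun j l => (Qp y (l + 1 : ℕ)).coeff (j + 1 : ℕ)
  have hC : C.det = 1 := by
    rw [Matrix.det_of_isUpperTriangular]
    · apply Finset.prod_eq_one
      intro i _
      have := Qp_monic y (i + 1 : ℕ)
      rw [Polynomial.Monic, Polynomial.leadingCoeff, Qp_natDegree] at this
      exact this
    · intro i j hij
      change (Qp y (j + 1 : ℕ)).coeff (i + 1 : ℕ) = 0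
      apply Polynomial.coeff_eq_zero_of_natDegree_lt
      rw [Qp_natDegree]
      have : j < i := hij
      have : (j : ℕ) < i := this
      omega
  have hAC : A * C = Matrix.of fun c l : Fin n => Lf y (c + 1 : ℕ) (Qp y (l + 1 : ℕ)) := by
    ext c l
    rw [Matrix.mul_apply]
    simp only [hA, C, Matrix.of_apply]
    have h1 := Polynomial.as_sum_range' (Qp y (l + 1 : ℕ)) (n + 1) (by rw [Qp_natDegree]; have := l.2; omega)
    conv_rhs => rw [h1, Finset.sum_range_succ']
    rw [map_add, map_sum, ← Fin.sum_univ_eq_sum_range (fun x => Lf y (c + 1 : ℕ) ((Polynomial.monomial (x + 1)) ((Qp y (↑l + 1)).coeff (x + 1))))]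
    have h0 : Lf y (c + 1 : ℕ) (Polynomial.monomial 0 ((Qp y (l + 1 : ℕ)).coeff 0)) = 0 := by
      rw [← mul_one ((Qp y (l + 1 : ℕ)).coeff 0), ← smul_eq_mul, ← Polynomial.smul_monomial, map_smul]
      simp [Lf_one]
    rw [h0, add_zero]
    apply Finset.sum_congr rfl
    intro j _
    rw [← Polynomial.smul_X_eq_monomial, map_smul, smul_eq_mul, mul_comm]
  have : A.det = (A * C).det := by rw [Matrix.det_mul, hC, mul_one]
  rw [this, hAC, Matrix.det_of_isLowerTriangular]
  · rw [← Fin.prod_univ_eq_prod_range (fun c => (Qp y (2 * ((c + 1) / 2))).eval (y ((c + 1) / 2)))]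
    apply Finset.prod_congr rfl
    intro i _
    exact Lf_Qp_diag y _ (by omega)
  · intro i j hij
    have : i < j := hij
    have : (i : ℕ) < j := this
    exact Lf_Qp_lt y _ _ (by omega)

/-- squared differences -/
def Dp (y : ℕ → ℝ) (i : ℕ) : ℝ := ∏ j ∈ Finset.range i, (y i - y j) ^ 2

lemma Qp_even_eval (y : ℕ → ℝ) (t : ℝ) (i : ℕ) :
    (Qp y (2 * i)).eval t = ∏ j ∈ Finset.range i, (t - y j) ^ 2 := by
  induction i with
  | zero => simp [Qp]
  | succ i ih =>
    rw [show 2 * (i + 1) = 2 * i + 1 + 1 by ring, Qp_succ, Qp_succ, Finset.prod_range_succ, ← ih]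
    have h1 : 2 * i / 2 = i := by omega
    have h2 : (2 * i + 1) / 2 = i := by omega
    simp [h1, h2]
    ring

lemma det_confl' (y : ℕ → ℝ) (N : ℕ) (hN : 1 ≤ N) :
    (Matrix.of fun c j : Fin (2 * N - 1) => Lf y (c + 1 : ℕ) (Polynomial.X ^ (j + 1 : ℕ))).det =
      (∏ i ∈ Finset.range N, Dp y i) ^ 2 := by
  rw [det_confl]
  simp_rw [Qp_even_eval]
  change ∏ c ∈ Finset.range (2 * N - 1), Dp y ((c + 1) / 2) = _
  induction N, hN using Nat.le_induction with
  | base => simp [Dp]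
  | succ N hN ih =>
    rw [show 2 * (N + 1) - 1 = 2 * N - 1 + 1 + 1 by omega, Finset.prod_range_succ,
      Finset.prod_range_succ, ih, Finset.prod_range_succ]
    rw [show (2 * N - 1 + 1) / 2 = N by omega, show (2 * N - 1 + 1 + 1) / 2 = N by omega]
    ring

lemma vdm_Dp (y : ℕ → ℝ) (N : ℕ) :
    (Matrix.vandermonde (fun i : Fin N => y i)).det ^ 2 = ∏ i ∈ Finset.range N, Dp y i := by
  rw [Matrix.det_vandermonde]
  rw [Finset.prod_comm' (t' := Finset.univ) (s' := fun j => Finset.Iio j) (by simp), ← Finset.prod_pow,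
    ← Fin.prod_univ_eq_prod_range]
  apply Finset.prod_congr rfl
  intro i _
  rw [← Finset.prod_pow, Dp, ← Fin.prod_univ_eq_prod_range (fun j => (y i - y j)^2)]
  symm
  apply Finset.prod_bij (fun (a : Fin (i : ℕ)) _ => (⟨a, by have := a.2; have := i.2; omega⟩ : Fin N))
  · intro a _; rw [Finset.mem_Iio, Fin.lt_def]; exact a.2
  · intro a _ b _ h; simpa [Fin.ext_iff] using h
  · intro b hb; rw [Finset.mem_Iio, Fin.lt_def] at hb; exact ⟨⟨b, hb⟩, by simp, rfl⟩
  · intros; rfl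

/-- moments as a function of nodes and weights -/
def Gm (N : ℕ) (y : Fin (2 * N - 1) → ℝ) : Fin (2 * N - 1) → ℝ :=
  fun j => ∑ n : Fin N, wExt (wPart y) n * (xPart y n) ^ (j + 1 : ℕ)

lemma contDiff_Gm (N : ℕ) : ContDiff ℝ 1 (Gm N) := by
  rw [contDiff_pi]
  intro j
  unfold Gm
  apply ContDiff.sum
  intro n _
  apply ContDiff.mul
  · unfold wExt wPart
    split_ifs
    · exact contDiff_apply ℝ ℝ _
    · exact contDiff_const.sub (ContDiff.sum fun i _ => contDiff_apply ℝ ℝ _)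
  · exact (contDiff_apply ℝ ℝ _).pow _

/-- reversed interleaving -/
def rilvFun (N : ℕ) (j : Fin (2 * N - 1)) : Fin (2 * N - 1) :=
  ⟨if (j : ℕ) % 2 = 0 then N - 1 - (j : ℕ) / 2 else N + (N - 2 - (j : ℕ) / 2),
    by have := j.isLt; split_ifs <;> omega⟩

lemma rilvFun_injective (N : ℕ) : Function.Injective (rilvFun N) := by
  intro i j h
  have hi := i.isLt
  have hj := j.isLt
  simp only [rilvFun, Fin.mk.injEq] at h
  ext
  split_ifs at h <;> omega

/-- reversed interleaving as a permutation -/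
def rilv (N : ℕ) : Fin (2 * N - 1) ≃ Fin (2 * N - 1) :=
  Equiv.ofBijective (rilvFun N) (Finite.injective_iff_bijective.1 (rilvFun_injective N))


/-- linear part of the weight extension -/
def wLin {N : ℕ} (w : Fin (N - 1) → ℝ) : Fin N → ℝ :=
  fun n => if h : (n : ℕ) < N - 1 then w ⟨n, h⟩ else - ∑ i, w i

lemma wExt_line {N : ℕ} (w v : Fin (N - 1) → ℝ) (t : ℝ) (n : Fin N) :
    wExt (w + t • v) n = wExt w n + t * wLin v n := by
  unfold wExt wLin
  split_ifs
  · simp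
  · simp only [Pi.add_apply, Pi.smul_apply, smul_eq_mul, Finset.sum_add_distrib, ← Finset.mul_sum]
    ring

lemma fderiv_dir {n m : ℕ} (F : (Fin n → ℝ) → (Fin m → ℝ)) (p v : Fin n → ℝ) (j : Fin m) (c : ℝ)
    (hF : DifferentiableAt ℝ F p) (h3 : HasDerivAt (fun t : ℝ => F (p + t • v) j) c 0) :
    fderiv ℝ F p v j = c := by
  have h1 := hF.hasFDerivAt.hasLineDerivAt v
  unfold HasLineDerivAt at h1
  have h2 := (hasDerivAt_pi.1 h1) j
  exact h2.unique h3

lemma fderiv_Gm (N : ℕ) (y v : Fin (2 * N - 1) → ℝ) (j : Fin (2 * N - 1)) :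
    fderiv ℝ (Gm N) y v j = ∑ n : Fin N, (wLin (wPart v) n * (xPart y n) ^ (j + 1 : ℕ) +
      wExt (wPart y) n * (((j + 1 : ℕ) : ℝ) * (xPart y n) ^ (j : ℕ) * xPart v n)) := by
  apply fderiv_dir
  · exact (contDiff_Gm N).differentiable (by norm_num) y
  · have e : (fun t : ℝ => Gm N (y + t • v) j) = fun t => ∑ n : Fin N,
        (wExt (wPart y) n + t * wLin (wPart v) n) * (xPart y n + t * xPart v n) ^ (j + 1 : ℕ) := by
      ext t
      unfold Gm
      apply Finset.sum_congr rfl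
      intro n _
      rw [← wExt_line]
      rfl
    rw [e]
    apply HasDerivAt.fun_sum
    intro n _
    have h1 : HasDerivAt (fun t : ℝ => wExt (wPart y) n + t * wLin (wPart v) n) (wLin (wPart v) n) 0 := by
      simpa using ((hasDerivAt_id (0:ℝ)).mul_const (wLin (wPart v) n)).const_add (wExt (wPart y) n)
    have h2 : HasDerivAt (fun t : ℝ => xPart y n + t * xPart v n) (xPart v n) 0 := by
      simpa using ((hasDerivAt_id (0:ℝ)).mul_const (xPart v n)).const_add (xPart y n)
    refine (h1.fun_mul (h2.fun_pow (j + 1 : ℕ))).congr_deriv ?_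
    simp

/-- reversed extension of a tuple -/
def revSeq {N : ℕ} (x : Fin N → ℝ) (i : ℕ) : ℝ := if h : i < N then x (Fin.rev ⟨i, h⟩) else 0

lemma prod_even (g : ℕ → ℝ) (N : ℕ) (hN : 1 ≤ N) :
    ∏ c ∈ Finset.range (2 * N - 1), (if c % 2 = 0 then g (c / 2) else 1) =
      ∏ i ∈ Finset.range N, g i := by
  induction N, hN using Nat.le_induction with
  | base => simp
  | succ N hN ih =>
    rw [show 2 * (N + 1) - 1 = 2 * N - 1 + 1 + 1 by omega, Finset.prod_range_succ,
      Finset.prod_range_succ, ih, Finset.prod_range_succ, if_neg (by omega), if_pos (by omega),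
      show (2 * N - 1 + 1) / 2 = N by omega]
    ring

lemma prod_revSeq {N : ℕ} (x : Fin N → ℝ) : ∏ i ∈ Finset.range N, revSeq x i = ∏ n, x n := by
  rw [← Fin.prod_univ_eq_prod_range, ← Equiv.prod_comp Fin.revPerm x]
  apply Finset.prod_congr rfl
  intro i _
  simp [revSeq]

lemma vdm_rev {N : ℕ} (x : Fin N → ℝ) :
    ∏ i ∈ Finset.range N, Dp (revSeq x) i = (Matrix.vandermonde x).det ^ 2 := by
  rw [← vdm_Dp, ← sq_abs, ← sq_abs (Matrix.det (Matrix.vandermonde x)),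
    ← Matrix.abs_det_submatrix_equiv_equiv Fin.revPerm (Equiv.refl _) (Matrix.vandermonde x)]
  congr 3
  ext i j
  simp [Matrix.vandermonde, revSeq]

lemma xPart_single_lt (N : ℕ) (k : Fin N) (c : Fin (2 * N - 1)) (hc : (c : ℕ) = k) :
    xPart (N := N) (Pi.single c (1 : ℝ)) = Pi.single k 1 := by
  ext n
  simp [xPart, Pi.single_apply, Fin.ext_iff, hc]

lemma wPart_single_lt (N : ℕ) (k : Fin N) (c : Fin (2 * N - 1)) (hc : (c : ℕ) = k) :
    wPart (N := N) (Pi.single c (1 : ℝ)) = 0 := by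
  ext n
  have := k.2
  simp [wPart, Pi.single_apply, Fin.ext_iff, hc]
  omega

lemma xPart_single_ge (N : ℕ) (k : Fin (N - 1)) (c : Fin (2 * N - 1)) (hc : (c : ℕ) = N + k) :
    xPart (N := N) (Pi.single c (1 : ℝ)) = 0 := by
  ext n
  have := n.2
  simp [xPart, Pi.single_apply, Fin.ext_iff, hc]
  omega

lemma wPart_single_ge (N : ℕ) (k : Fin (N - 1)) (c : Fin (2 * N - 1)) (hc : (c : ℕ) = N + k) :
    wPart (N := N) (Pi.single c (1 : ℝ)) = Pi.single k 1 := by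
  ext n
  simp [wPart, Pi.single_apply, Fin.ext_iff, hc]

lemma fderiv_Gm_col (N : ℕ) (y : Fin (2 * N - 1) → ℝ) (c j : Fin (2 * N - 1)) :
    fderiv ℝ (Gm N) y (Pi.single (rilv N c) 1) j =
      (if (c : ℕ) % 2 = 0 then revSeq (wExt (wPart y)) ((c : ℕ) / 2) else 1) *
        Lf (revSeq (xPart y)) (c + 1 : ℕ) (Polynomial.X ^ (j + 1 : ℕ)) := by
  have hc2 := c.2
  rw [fderiv_Gm]
  by_cases hc : (c : ℕ) % 2 = 0
  · have hr : ((rilv N c : Fin (2 * N - 1)) : ℕ) = (⟨N - 1 - (c : ℕ) / 2, by omega⟩ : Fin N) := by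
      simp [rilv, rilvFun, hc]
    rw [xPart_single_lt N _ _ hr, wPart_single_lt N _ _ hr, if_pos hc]
    have h0 : ∀ n : Fin N, wLin (N := N) 0 n = 0 := by intro n; simp [wLin]
    simp only [h0, zero_mul, zero_add]
    rw [Finset.sum_eq_single (⟨N - 1 - (c : ℕ) / 2, by omega⟩ : Fin N)]
    · rw [Lf, if_neg (by omega), show ((c : ℕ) + 1) / 2 = (c : ℕ) / 2 by omega]
      have hr2 : (Fin.rev ⟨(c : ℕ) / 2, by omega⟩ : Fin N) = ⟨N - 1 - (c : ℕ) / 2, by omega⟩ := by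
        ext; simp [Fin.rev]; omega
      rw [revSeq, dif_pos (by omega), revSeq, dif_pos (by omega), hr2]
      simp [Polynomial.leval]
    · intro b _ hb
      simp [hb]
    · simp
  · have hr : ((rilv N c : Fin (2 * N - 1)) : ℕ) = N + (⟨N - 2 - (c : ℕ) / 2, by omega⟩ : Fin (N - 1)) := by
      simp [rilv, rilvFun, hc]
    rw [xPart_single_ge N _ _ hr, wPart_single_ge N _ _ hr, if_neg hc]
    simp only [Pi.zero_apply, mul_zero, add_zero, one_mul]
    obtain ⟨N, rfl⟩ : ∃ M, N = M + 1 := ⟨N - 1, by omega⟩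
    rw [Fin.sum_univ_castSucc, Finset.sum_eq_single (⟨N + 1 - 2 - (c : ℕ) / 2, by omega⟩ : Fin N)]
    · rw [Lf, if_pos (by omega), revSeq, dif_pos (by omega), revSeq, dif_pos (by omega)]
      have hr2 : (Fin.rev ⟨((c : ℕ) + 1) / 2, by omega⟩ : Fin (N + 1)) =
          Fin.castSucc ⟨N + 1 - 2 - (c : ℕ) / 2, by omega⟩ := by
        ext; simp [Fin.rev]; omega
      have hr3 : (Fin.rev ⟨0, by omega⟩ : Fin (N + 1)) = Fin.last N := by
        ext; simp [Fin.rev]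
      rw [hr2, hr3]
      simp [Polynomial.leval, wLin]
      rw [if_pos (by omega)]
      ring
    · intro b _ hb
      simp [wLin, Pi.single_apply]
      exact fun h => absurd h hb
    · simp

lemma det_Gm (N : ℕ) (hN : 1 ≤ N) (y : Fin (2 * N - 1) → ℝ) :
    |LinearMap.det (fderiv ℝ (Gm N) y).toLinearMap| =
      |(∏ n, wExt (N := N) (wPart y) n) * ((Matrix.vandermonde (xPart (N := N) y)).det ^ 2) ^ 2| := by
  rw [← LinearMap.det_toMatrix', ← Matrix.abs_det_submatrix_equiv_equiv (Equiv.refl _) (rilv N),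
    ← Matrix.det_transpose]
  have e : ((LinearMap.toMatrix' (fderiv ℝ (Gm N) y).toLinearMap).submatrix (Equiv.refl _) (rilv N))ᵀ =
    Matrix.diagonal (fun c : Fin (2 * N - 1) =>
      if (c : ℕ) % 2 = 0 then revSeq (wExt (N := N) (wPart y)) ((c : ℕ) / 2) else 1) *
    Matrix.of fun c j : Fin (2 * N - 1) =>
      Lf (revSeq (xPart (N := N) y)) (c + 1 : ℕ) (Polynomial.X ^ (j + 1 : ℕ)) := by
    ext c j
    rw [Matrix.diagonal_mul]
    simp only [Matrix.transpose_apply, Matrix.submatrix_apply, LinearMap.toMatrix'_apply, Equiv.refl_apply,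
      Matrix.of_apply]
    exact fderiv_Gm_col N y c j
  rw [e, Matrix.det_mul, Matrix.det_diagonal, det_confl' _ N hN, vdm_rev,
    Fin.prod_univ_eq_prod_range (fun c => if c % 2 = 0 then revSeq (wExt (N := N) (wPart y)) (c / 2) else 1),
    prod_even _ N hN, prod_revSeq]


lemma herm_pow_apply {n : Type*} [Fintype n] [DecidableEq n] (A : Matrix n n ℝ) (hA : A.IsHermitian)
    (k : ℕ) (i : n) :
    (A ^ k) i i = ∑ l, (hA.eigenvectorBasis l i) ^ 2 * hA.eigenvalues l ^ k := by
  have h : A ^ k = _ := congrArg (fun M : Matrix n n ℝ => M ^ k) hA.spectral_theorem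
  rw [h, ← map_pow, Matrix.diagonal_pow, Unitary.conjStarAlgAut_apply, Matrix.mul_apply]
  apply Finset.sum_congr rfl
  intro l _
  rw [Matrix.mul_diagonal]
  simp [Matrix.star_apply]
  ring

lemma moments_spec {N : ℕ} (hN : 0 < N) (a : Fin N → ℝ) (b : Fin (N - 1) → ℝ) (k : ℕ) :
    (jacobiMatrix a b ^ k) ⟨0, hN⟩ ⟨0, hN⟩ =
      ∑ n, jacobiWeights hN a b n * jacobiEigs a b n ^ k := by
  rw [herm_pow_apply _ (jacobiMatrix_isHermitian a b),
    ← Equiv.sum_comp (Fin.revPerm.trans (Tuple.sort (jacobiMatrix_isHermitian a b).eigenvalues))]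
  rfl

lemma jacobi_row (N : ℕ) (p : Fin (2 * N - 1) → ℝ) (g : ℕ → ℝ) (i : Fin N) :
    ∑ j : Fin N, jacobiMatrix (xPart p) (wPart p) i j * g j =
      qOf N p (2 * i) * g i + √(qOf N p (2 * i + 1)) * g (i + 1) +
        (if (i : ℕ) = 0 then 0 else √(qOf N p (2 * i - 1)) * g (i - 1)) := by
  have hi := i.2
  have e : ∀ j : Fin N, jacobiMatrix (xPart p) (wPart p) i j * g j =
      (if (i : ℕ) = j then qOf N p (2 * i) * g i else 0) +
      (if (i : ℕ) + 1 = j then √(qOf N p (2 * i + 1)) * g (i + 1) else 0) +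
      (if (i : ℕ) - 1 = j then (if (i : ℕ) = 0 then 0 else √(qOf N p (2 * i - 1)) * g (i - 1)) else 0) := by
    intro j
    have hj := j.2
    simp only [jacobiMatrix, Matrix.of_apply]
    by_cases h1 : i = j
    · subst h1
      rw [if_pos rfl, if_pos rfl, if_neg (by omega : ¬ (i : ℕ) + 1 = i), qOf_even N p i i.2]
      by_cases h0 : (i : ℕ) = 0
      · rw [if_pos h0]; simp
      · rw [if_neg (by omega : ¬ (i : ℕ) - 1 = i)]; simp
    have h1' : ¬ (i : ℕ) = j := fun h => h1 (Fin.ext h)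
    rw [if_neg h1, if_neg h1']
    by_cases h2 : (i : ℕ) + 1 = j
    · rw [dif_pos h2, if_pos h2, if_neg (by omega), qOf_odd N p i (by omega), h2]; simp
    rw [dif_neg h2, if_neg h2]
    by_cases h3 : (j : ℕ) + 1 = i
    · rw [dif_pos h3, if_pos (by omega), if_neg (by omega), ← h3,
        show 2 * ((j : ℕ) + 1) - 1 = 2 * j + 1 by omega, qOf_odd N p j (by omega)]; simp
    rw [dif_neg h3]
    by_cases h0 : (i : ℕ) = 0
    · simp [h0]
    · rw [if_neg (by omega)]; simp
  rw [Finset.sum_congr rfl fun j _ => e j, Finset.sum_add_distrib, Finset.sum_add_distrib]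
  have s : ∀ (m : ℕ) (c : ℝ), ∑ j : Fin N, (if m = (j : ℕ) then c else 0) = if m < N then c else 0 := by
    intro m c
    rw [Fin.sum_univ_eq_sum_range (fun j => if m = j then c else 0)]
    simp
  rw [s, s, s, if_pos hi, if_pos (by omega : (i : ℕ) - 1 < N)]
  by_cases h : (i : ℕ) + 1 < N
  · rw [if_pos h]
  · rw [if_neg h, qOf_top N p (2 * i + 1) (by omega)]; simp

lemma bet_qOf_nonneg (N : ℕ) (p : Fin (2 * N - 1) → ℝ) (hp : ∀ i, 0 < wPart p i) (k : ℕ) :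
    0 ≤ qOf N p (2 * k + 1) := by
  by_cases h : k < N - 1
  · rw [qOf_odd N p k h]; exact (hp _).le
  · rw [qOf_top N p _ (by omega)]

lemma jacobi_pow_col (N : ℕ) (hN : 0 < N) (p : Fin (2 * N - 1) → ℝ) (hp : ∀ i, 0 < wPart p i) (k : ℕ)
    (i : Fin N) :
    (jacobiMatrix (xPart p) (wPart p) ^ k) i ⟨0, hN⟩ = Lc (qOf N p) k i * √(bet (qOf N p) i) := by
  have hb : ∀ k, 0 ≤ bet (qOf N p) k := fun k => Finset.prod_nonneg fun i _ => bet_qOf_nonneg N p hp i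
  have hs : ∀ k, √(bet (qOf N p) (k + 1)) = √(bet (qOf N p) k) * √(qOf N p (2 * k + 1)) := by
    intro k
    rw [bet_succ, Real.sqrt_mul (hb k)]
  induction k generalizing i with
  | zero =>
    by_cases h : i = ⟨0, hN⟩
    · subst h; simp [Lc, bet]
    · have : ¬ (i : ℕ) = 0 := fun h' => h (Fin.ext h')
      simp [Lc, h, this]
  | succ k ih =>
    rw [pow_succ', Matrix.mul_apply, Finset.sum_congr rfl fun j _ => by rw [ih j],
      jacobi_row N p (fun j => Lc (qOf N p) k j * √(bet (qOf N p) j)) i]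
    have hq := Real.mul_self_sqrt (bet_qOf_nonneg N p hp i)
    generalize (i : ℕ) = i at *
    rcases i with _ | i
    · rw [Lc, hs]
      simp at hq ⊢
      linear_combination (Lc (qOf N p) k 1 * √(bet (qOf N p) 0)) * hq
    · rw [Lc, hs (i+1)]
      rw [show 2 * (i + 1) - 1 = 2 * i + 1 by omega, show 2 * (i+1) + 1 = 2 * i + 3 by ring] at *
      simp only [Nat.add_sub_cancel, Nat.succ_ne_zero, if_false]
      rw [hs i, show 2 * (i + 1) = 2 * i + 2 by ring]
      linear_combination (Lc (qOf N p) k (i + 2) * √(bet (qOf N p) i) * √(qOf N p (2 * i + 1))) * hq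

lemma moments_eq (N : ℕ) (hN : 0 < N) (p : Fin (2 * N - 1) → ℝ) (hp : ∀ i, 0 < wPart p i) (k : ℕ) :
    Lc (qOf N p) k 0 = ∑ n, jacobiWeights hN (xPart p) (wPart p) n * jacobiEigs (xPart p) (wPart p) n ^ k := by
  rw [← moments_spec, jacobi_pow_col N hN p hp]
  simp [bet]

lemma hank_vdm {N : ℕ} (x W : Fin N → ℝ) :
    (Matrix.of fun j k : Fin N => ∑ n, W n * x n ^ (j + k : ℕ)) =
      (Matrix.vandermonde x)ᵀ * Matrix.diagonal W * Matrix.vandermonde x := by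
  ext j k
  rw [Matrix.mul_apply]
  simp only [Matrix.mul_diagonal, Matrix.transpose_apply, Matrix.of_apply, Matrix.vandermonde]
  exact Finset.sum_congr rfl fun _ _ => by ring

lemma hank_spec (N : ℕ) (hN : 0 < N) (p : Fin (2 * N - 1) → ℝ) (hp : ∀ i, 0 < wPart p i) :
    ∏ k ∈ Finset.range N, bet (qOf N p) k =
      (∏ n, jacobiWeights hN (xPart p) (wPart p) n) *
        (Matrix.vandermonde (jacobiEigs (xPart p) (wPart p))).det ^ 2 := by
  rw [← hank_det]
  simp_rw [moments_eq N hN p hp]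
  rw [hank_vdm, Matrix.det_mul, Matrix.det_mul, Matrix.det_transpose, Matrix.det_diagonal]
  ring

lemma spec_mem (N : ℕ) (hN : 2 ≤ N) (p : Fin (2 * N - 1) → ℝ) (hp : ∀ i, 0 < wPart p i) :
    (∀ n, 0 < jacobiWeights (N := N) (lt_of_lt_of_le two_pos hN) (xPart p) (wPart p) n) ∧
    ∑ n, jacobiWeights (N := N) (lt_of_lt_of_le two_pos hN) (xPart p) (wPart p) n = 1 ∧
    StrictAnti (jacobiEigs (N := N) (xPart p) (wPart p)) := by
  have h0 : 0 < ∏ k ∈ Finset.range N, bet (qOf N p) k :=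
    Finset.prod_pos fun i hi => bet_pos N p hp i (by simpa using hi)
  rw [hank_spec N (lt_of_lt_of_le two_pos hN) p hp] at h0
  refine ⟨?_, ?_, ?_⟩
  · intro n
    have h1 := left_ne_zero_of_mul h0.ne'
    rw [Finset.prod_ne_zero_iff] at h1
    have h2 := h1 n (Finset.mem_univ _)
    exact lt_of_le_of_ne (sq_nonneg _) (Ne.symm h2)
  · have := moments_eq N (lt_of_lt_of_le two_pos hN) p hp 0
    simpa [Lc] using this.symm
  · have h1 := right_ne_zero_of_mul h0.ne'
    have h2 := Matrix.det_vandermonde_ne_zero_iff.1 (pow_ne_zero_iff (two_ne_zero) |>.1 h1)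
    have h3 : Antitone (jacobiEigs (N := N) (xPart p) (wPart p)) := by
      intro i j hij
      exact Tuple.monotone_sort (jacobiMatrix_isHermitian (xPart p) (wPart p)).eigenvalues (Fin.rev_le_rev.2 hij)
    exact h3.strictAnti_of_injective h2

lemma xPart_spec (N : ℕ) (hN : 0 < N) (p : Fin (2 * N - 1) → ℝ) :
    xPart (specRolled N hN p) = jacobiEigs (xPart p) (wPart p) := by
  ext i
  simp [xPart, specRolled]

lemma wPart_spec (N : ℕ) (hN : 0 < N) (p : Fin (2 * N - 1) → ℝ) (i : Fin (N - 1)) :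
    wPart (specRolled N hN p) i = jacobiWeights hN (xPart p) (wPart p) ⟨i, by omega⟩ := by
  simp [wPart, specRolled]

lemma sum_split {N : ℕ} (hN : 0 < N) (W : Fin N → ℝ) :
    ∑ n, W n = ∑ i : Fin (N - 1), W ⟨i, by omega⟩ + W ⟨N - 1, by omega⟩ := by
  obtain ⟨N, rfl⟩ : ∃ M, N = M + 1 := ⟨N - 1, by omega⟩
  rw [Fin.sum_univ_castSucc]
  rfl

lemma wExt_of_sum {N : ℕ} (hN : 0 < N) (W : Fin N → ℝ) (w : Fin (N - 1) → ℝ) (h1 : ∑ n, W n = 1)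
    (hw : ∀ i : Fin (N - 1), w i = W ⟨i, by omega⟩) : wExt w = W := by
  ext n
  have := n.2
  unfold wExt
  split_ifs with h
  · exact hw _
  · rw [Finset.sum_congr rfl fun i _ => hw i, ← h1, sum_split hN]
    have : n = ⟨N - 1, by omega⟩ := by ext; simp; omega
    rw [this]; ring

lemma sum_wExt {N : ℕ} (hN : 0 < N) (w : Fin (N - 1) → ℝ) : ∑ n, wExt (N := N) w n = 1 := by
  rw [sum_split hN]
  simp [wExt]

lemma wExt_spec (N : ℕ) (hN : 2 ≤ N) (p : Fin (2 * N - 1) → ℝ) (hp : ∀ i, 0 < wPart p i) :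
    wExt (wPart (specRolled N (lt_of_lt_of_le two_pos hN) p)) = jacobiWeights (N := N) (lt_of_lt_of_le two_pos hN) (xPart p) (wPart p) :=
  wExt_of_sum (lt_of_lt_of_le two_pos hN) _ _ (spec_mem N hN p hp).2.1 (wPart_spec N _ p)

lemma spec_mapsTo (N : ℕ) (hN : 2 ≤ N) (p : Fin (2 * N - 1) → ℝ) (hp : ∀ i, 0 < wPart p i) :
    specRolled N (lt_of_lt_of_le two_pos hN) p ∈ nodeWeightDom N := by
  obtain ⟨h1, h2, h3⟩ := spec_mem N hN p hp
  refine ⟨?_, ?_, ?_⟩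
  · rw [xPart_spec]; exact fun i j hij => h3 hij
  · intro i; rw [wPart_spec]; exact h1 _
  · rw [Finset.sum_congr rfl fun i _ => wPart_spec N (lt_of_lt_of_le two_pos hN) p i]
    rw [sum_split (lt_of_lt_of_le two_pos hN)] at h2
    have := h1 ⟨N - 1, by omega⟩
    linarith

lemma Fm_eq_Gm (N : ℕ) (hN : 2 ≤ N) (p : Fin (2 * N - 1) → ℝ) (hp : ∀ i, 0 < wPart p i) :
    Fm N p = Gm N (specRolled N (lt_of_lt_of_le two_pos hN) p) := by
  ext j
  rw [Fm, Gm, moments_eq N (lt_of_lt_of_le two_pos hN) p hp, wExt_spec N hN p hp, xPart_spec]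

lemma wExt_pos {N : ℕ} (w : Fin (N - 1) → ℝ) (hw : w ∈ openSimplex N) (n : Fin N) : 0 < wExt w n := by
  unfold wExt
  split_ifs
  · exact hw.1 _
  · linarith [hw.2]

lemma Gm_surj (N : ℕ) (hN : 2 ≤ N) (y : Fin (2 * N - 1) → ℝ) (hy : y ∈ nodeWeightDom N) :
    ∃ p : Fin (2 * N - 1) → ℝ, (∀ i, 0 < wPart p i) ∧ Fm N p = Gm N y := by
  have hV : (Matrix.vandermonde (xPart (N := N) y)).det ≠ 0 := by
    rw [Matrix.det_vandermonde_ne_zero_iff]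
    have : StrictAnti (xPart (N := N) y) := fun i j hij => hy.1 i j hij
    exact this.injective
  have hpd : (Matrix.of fun j k : Fin N => ∑ n, wExt (wPart y) n * xPart y n ^ (j + k : ℕ)).PosDef := by
    rw [hank_vdm]
    have := Matrix.PosDef.conjTranspose_mul_mul_same (A := Matrix.diagonal (wExt (N := N) (wPart y)))
      (Matrix.PosDef.diagonal fun n => wExt_pos _ hy.2 n) (B := Matrix.vandermonde (xPart (N := N) y))
      (Matrix.mulVec_injective_iff_isUnit.2 ((Matrix.isUnit_iff_isUnit_det _).2 hV.isUnit))
    rwa [Matrix.conjTranspose_eq_transpose_of_trivial] at this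
  obtain ⟨p, hp, h⟩ := Fm_solve N hN (fun k => ∑ n : Fin N, wExt (wPart y) n * xPart y n ^ k)
    (by simpa using sum_wExt (lt_of_lt_of_le two_pos hN) _) (by
      intro n hn
      exact (hpd.submatrix (e := Fin.castLE hn) (Fin.castLE_injective hn)).det_pos)
  exact ⟨p, hp, funext h⟩

lemma Gm_inj (N : ℕ) (hN : 2 ≤ N) : Set.InjOn (Gm N) (nodeWeightDom N) := by
  intro y hy y' hy' h
  set x := xPart (N := N) y with hx
  set x' := xPart (N := N) y' with hx'
  set W := wExt (N := N) (wPart y) with hW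
  set W' := wExt (N := N) (wPart y') with hW'
  have sx : StrictAnti x := fun i j hij => hy.1 i j hij
  have sx' : StrictAnti x' := fun i j hij => hy'.1 i j hij
  have mono : ∀ k, k < 2 * N → ∑ n, W n * x n ^ k = ∑ n, W' n * x' n ^ k := by
    intro k hk
    rcases k with _ | k
    · simpa using (sum_wExt (lt_of_lt_of_le two_pos hN) _).trans (sum_wExt (lt_of_lt_of_le two_pos hN) _).symm
    · exact congrFun h ⟨k, by omega⟩
  have poly : ∀ f : Polynomial ℝ, f.natDegree < 2 * N → ∑ n, W n * f.eval (x n) = ∑ n, W' n * f.eval (x' n) := by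
    intro f hf
    simp_rw [Polynomial.eval_eq_sum_range' hf, Finset.mul_sum]
    rw [Finset.sum_comm, Finset.sum_comm (s := Finset.univ (α := Fin N))]
    apply Finset.sum_congr rfl
    intro k hk
    have := mono k (by simpa using hk)
    have e : ∀ a b : Fin N → ℝ, ∑ n, a n * (f.coeff k * b n ^ k) = f.coeff k * ∑ n, a n * b n ^ k := by
      intro a b; rw [Finset.mul_sum]; exact Finset.sum_congr rfl fun _ _ => by ring
    rw [e, e, this]
  have pd : ∀ (s : Finset (Fin N)) (z : Fin N → ℝ),
      (∏ m ∈ s, (Polynomial.X - Polynomial.C (z m))).natDegree = s.card := by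
    intro s z
    rw [Polynomial.natDegree_prod_of_monic _ _ fun _ _ => Polynomial.monic_X_sub_C _]
    simp
  have pe : ∀ (s : Finset (Fin N)) (z : Fin N → ℝ) (t : ℝ),
      (∏ m ∈ s, (Polynomial.X - Polynomial.C (z m))).eval t = ∏ m ∈ s, (t - z m) := by
    intro s z t
    simp [Polynomial.eval_prod]
  have hsub : Set.range x ⊆ Set.range x' := by
    rintro _ ⟨n, rfl⟩
    by_contra hn
    have := poly ((∏ m, (Polynomial.X - Polynomial.C (x' m))) *
      ∏ m ∈ Finset.univ.erase n, (Polynomial.X - Polynomial.C (x m))) (by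
        refine lt_of_le_of_lt Polynomial.natDegree_mul_le ?_
        rw [pd, pd]
        simp
        omega)
    simp only [Polynomial.eval_mul, pe] at this
    rw [Finset.sum_eq_single n, Finset.sum_eq_zero] at this
    · rcases mul_eq_zero.1 this with h1 | h1
      · exact (wExt_pos _ hy.2 n).ne' h1
      rcases mul_eq_zero.1 h1 with h1 | h1
      · obtain ⟨m, _, hm⟩ := Finset.prod_eq_zero_iff.1 h1
        exact hn ⟨m, by linarith⟩
      · obtain ⟨m, hm', hm⟩ := Finset.prod_eq_zero_iff.1 h1
        exact (Finset.ne_of_mem_erase hm') (sx.injective (by linarith))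
    · intro m _
      rw [Finset.prod_eq_zero (i := m) (Finset.mem_univ _) (sub_self _)]; ring
    · intro m _ hm
      rw [Finset.prod_eq_zero (s := Finset.univ.erase n) (i := m) (by simpa using hm) (sub_self _)]; ring
    · simp
  have hrange : Set.range x = Set.range x' := by
    apply Set.eq_of_subset_of_ncard_le hsub
    rw [← Set.image_univ, ← Set.image_univ, Set.ncard_image_of_injective _ sx.injective,
      Set.ncard_image_of_injective _ sx'.injective]
  have hxx : x = x' := (sx.range_inj sx').1 hrange
  have hWW : W = W' := by
    ext n
    have := poly (∏ m ∈ Finset.univ.erase n, (Polynomial.X - Polynomial.C (x m))) (by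
        rw [pd]
        simp
        omega)
    simp only [pe] at this
    rw [← hxx] at this
    have z : ∀ m ≠ n, ∏ l ∈ Finset.univ.erase n, (x m - x l) = 0 := fun m hm =>
      Finset.prod_eq_zero (s := Finset.univ.erase n) (i := m) (by simpa using hm) (sub_self _)
    rw [Finset.sum_eq_single n (fun m _ hm => by rw [z m hm, mul_zero]) (by simp),
      Finset.sum_eq_single n (fun m _ hm => by rw [z m hm, mul_zero]) (by simp)] at this
    refine mul_right_cancel₀ ?_ this
    rw [Finset.prod_ne_zero_iff]
    intro m hm h0
    exact (Finset.ne_of_mem_erase hm) (sx.injective (by linarith))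
  ext c
  by_cases hc : (c : ℕ) < N
  · exact congrFun hxx ⟨c, hc⟩
  · have := congrFun hWW ⟨c - N, by omega⟩
    have hc2 := c.2
    simp only [hW, hW', wExt] at this
    rw [dif_pos (by omega), dif_pos (by omega)] at this
    simp only [wPart] at this
    have e : (⟨N + (c - N), by omega⟩ : Fin (2 * N - 1)) = c := by ext; simp; omega
    rwa [e] at this


lemma contDiffAt_of_factor {E : Type*} [NormedAddCommGroup E] [NormedSpace ℝ E] [FiniteDimensional ℝ E]
    (A B f : E → E) (S T : Set E) (hS : IsOpen S) (hT : IsOpen T) (hf : Set.MapsTo f S T)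
    (hA : ContDiff ℝ 1 A) (hB : ContDiff ℝ 1 B) (hAB : ∀ p ∈ S, A p = B (f p)) (hinj : Set.InjOn B T)
    (p : E) (hp : p ∈ S) (hdet : LinearMap.det (fderiv ℝ B (f p)).toLinearMap ≠ 0) :
    ContDiffAt ℝ 1 f p := by
  have : CompleteSpace E := FiniteDimensional.complete ℝ E
  let e : E ≃L[ℝ] E := ((fderiv ℝ B (f p)).toLinearMap.equivOfDetNeZero hdet).toContinuousLinearEquiv
  have he : (e : E →L[ℝ] E) = fderiv ℝ B (f p) := by
    ext v; rfl
  have hd : HasFDerivAt B (e : E →L[ℝ] E) (f p) := by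
    rw [he]
    exact (hB.differentiable (by norm_num) _).hasFDerivAt
  have hBa : ContDiffAt ℝ 1 B (f p) := hB.contDiffAt
  let H := hBa.toOpenPartialHomeomorph B hd (by norm_num)
  have hcoe : ∀ z, H z = B z := fun z => rfl
  have hmem : f p ∈ H.source := hBa.mem_toOpenPartialHomeomorph_source hd (by norm_num)
  have hmemt : A p ∈ H.target := by
    rw [hAB p hp]; exact hBa.image_mem_toOpenPartialHomeomorph_target hd (by norm_num)
  have hsymm : H.symm (A p) = f p := by
    rw [hAB p hp]; exact H.left_inv hmem
  have hc : ContDiffAt ℝ 1 H.symm (B (f p)) := hBa.to_localInverse hd (by norm_num)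
  have hc' : ContDiffAt ℝ 1 (fun q => H.symm (A q)) p := by
    rw [← hAB p hp] at hc
    exact hc.comp p hA.contDiffAt
  refine hc'.congr_of_eventuallyEq ?_
  have e1 : ∀ᶠ q in nhds p, q ∈ S := hS.mem_nhds hp
  have e2 : ∀ᶠ q in nhds p, A q ∈ H.target :=
    hA.continuous.continuousAt.eventually (H.open_target.mem_nhds hmemt)
  have e3 : ∀ᶠ q in nhds p, H.symm (A q) ∈ T := by
    apply hc'.continuousAt.eventually
    change ∀ᶠ y in nhds (H.symm (A p)), y ∈ T
    rw [hsymm]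
    exact hT.mem_nhds (hf hp)
  filter_upwards [e1, e2, e3] with q h1 h2 h3
  apply hinj (hf h1) h3
  rw [← hAB q h1, ← hcoe, H.right_inv h2]

lemma isOpen_dom (N : ℕ) : IsOpen {p : Fin (2 * N - 1) → ℝ | ∀ i, 0 < wPart p i} := by
  simp only [Set.ofPred_forall]
  exact isOpen_iInter_of_finite fun i => isOpen_lt continuous_const (continuous_apply _)

lemma isOpen_nodeWeightDom (N : ℕ) : IsOpen (nodeWeightDom N) := by
  have : nodeWeightDom N = {p : Fin (2 * N - 1) → ℝ | ∀ i j : Fin N, i < j → xPart p j < xPart p i} ∩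
      ({p | ∀ i, 0 < wPart p i} ∩ {p | ∑ i, wPart p i < 1}) := by
    ext p; rfl
  rw [this]
  refine IsOpen.inter ?_ ((isOpen_dom N).inter ?_)
  · simp only [Set.ofPred_forall]
    exact isOpen_iInter_of_finite fun i => isOpen_iInter_of_finite fun j =>
      isOpen_iInter_of_finite fun _ => isOpen_lt (continuous_apply _) (continuous_apply _)
  · exact isOpen_lt (continuous_finsetSum _ fun i _ => continuous_apply _) continuous_const

lemma det_Fm_ne (N : ℕ) (p : Fin (2 * N - 1) → ℝ) (hp : ∀ i, 0 < wPart p i) :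
    LinearMap.det (fderiv ℝ (Fm N) p).toLinearMap ≠ 0 := by
  rw [← abs_pos, det_Fm, abs_pos, Finset.prod_ne_zero_iff]
  intro i hi
  simp at hi
  exact (bet_pos N p hp _ (by omega)).ne'

lemma det_Gm_ne (N : ℕ) (hN : 2 ≤ N) (y : Fin (2 * N - 1) → ℝ) (hy : y ∈ nodeWeightDom N) :
    LinearMap.det (fderiv ℝ (Gm N) y).toLinearMap ≠ 0 := by
  have hV : (Matrix.vandermonde (xPart (N := N) y)).det ≠ 0 := by
    rw [Matrix.det_vandermonde_ne_zero_iff]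
    have : StrictAnti (xPart (N := N) y) := fun i j hij => hy.1 i j hij
    exact this.injective
  rw [← abs_pos, det_Gm N (lt_of_lt_of_le two_pos hN), abs_pos]
  refine mul_ne_zero ?_ (pow_ne_zero _ (pow_ne_zero _ hV))
  rw [Finset.prod_ne_zero_iff]
  exact fun n _ => (wExt_pos _ hy.2 n).ne'

lemma prod_half (g : ℕ → ℝ) (N : ℕ) (hN : 1 ≤ N) :
    (∏ c ∈ Finset.range (2 * N - 1), g (c / 2)) * g (N - 1) = (∏ i ∈ Finset.range N, g i) ^ 2 := by
  induction N, hN using Nat.le_induction with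
  | base => simp [sq]
  | succ N hN ih =>
    rw [show 2 * (N + 1) - 1 = 2 * N - 1 + 1 + 1 by omega, Finset.prod_range_succ,
      Finset.prod_range_succ, Finset.prod_range_succ, mul_pow, ← ih,
      show (2 * N - 1) / 2 = N - 1 by omega, show (2 * N - 1 + 1) / 2 = N by omega,
      Nat.add_sub_cancel]
    ring



/-- the spectral map is a C¹-diffeomorphism with the stated Jacobian. -/
theorem spectral_map_diffeomorphism (N : ℕ) (hN : 2 ≤ N) :
    Set.BijOn (specRolled N (by omega))
      {p : Fin (2 * N - 1) → ℝ | ∀ i, 0 < wPart p i} (nodeWeightDom N) ∧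
    ContDiffOn ℝ 1 (specRolled N (by omega))
      {p : Fin (2 * N - 1) → ℝ | ∀ i, 0 < wPart p i} ∧
    (∃ ψ : (Fin (2 * N - 1) → ℝ) → (Fin (2 * N - 1) → ℝ),
      ContDiffOn ℝ 1 ψ (nodeWeightDom N) ∧
      ∀ p ∈ {p : Fin (2 * N - 1) → ℝ | ∀ i, 0 < wPart p i},
        ψ (specRolled N (by omega) p) = p) ∧
    ∀ p ∈ {p : Fin (2 * N - 1) → ℝ | ∀ i, 0 < wPart p i},
      |LinearMap.det (fderiv ℝ (specRolled N (by omega)) p).toLinearMap|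
        = (∏ i : Fin (N - 1), (wPart p i)⁻¹) *
          ∏ n : Fin N, jacobiWeights (by omega) (xPart p) (wPart p) n := by
  have hN0 : 0 < N := by omega
  have hmaps : Set.MapsTo (specRolled N (by omega))
      {p : Fin (2 * N - 1) → ℝ | ∀ i, 0 < wPart p i} (nodeWeightDom N) :=
    fun p hp => spec_mapsTo N hN p hp
  have hinj : Set.InjOn (specRolled N (by omega))
      {p : Fin (2 * N - 1) → ℝ | ∀ i, 0 < wPart p i} := by
    intro p hp p' hp' h
    apply Fm_inj N hp hp'
    rw [Fm_eq_Gm N hN p hp, Fm_eq_Gm N hN p' hp', h]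
  have hsurj : Set.SurjOn (specRolled N (by omega))
      {p : Fin (2 * N - 1) → ℝ | ∀ i, 0 < wPart p i} (nodeWeightDom N) := by
    intro y hy
    obtain ⟨p, hp, h⟩ := Gm_surj N hN y hy
    refine ⟨p, hp, ?_⟩
    apply Gm_inj N hN (hmaps hp) hy
    rw [← Fm_eq_Gm N hN p hp, h]
  have hcd : ∀ p ∈ {p : Fin (2 * N - 1) → ℝ | ∀ i, 0 < wPart p i},
      ContDiffAt ℝ 1 (specRolled N (by omega)) p := fun p hp =>
    contDiffAt_of_factor (Fm N) (Gm N) _ _ _ (isOpen_dom N) (isOpen_nodeWeightDom N) hmaps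
      (contDiff_Fm N) (contDiff_Gm N) (fun p hp => Fm_eq_Gm N hN p hp) (Gm_inj N hN) p hp
      (det_Gm_ne N hN _ (hmaps hp))
  refine ⟨⟨hmaps, hinj, hsurj⟩, fun p hp => (hcd p hp).contDiffWithinAt, ?_, ?_⟩
  · have hinv : ∀ y ∈ nodeWeightDom N, ∃ p : Fin (2 * N - 1) → ℝ,
        (∀ i, 0 < wPart p i) ∧ specRolled N hN0 p = y := fun y hy => hsurj hy
    choose! ψ h1 h2 using hinv
    refine ⟨ψ, fun y hy => ?_, fun p hp => ?_⟩
    · refine (contDiffAt_of_factor (Gm N) (Fm N) ψ _ _ (isOpen_nodeWeightDom N) (isOpen_dom N)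
        (fun y hy => h1 y hy) (contDiff_Gm N) (contDiff_Fm N) (fun y hy => ?_) (Fm_inj N) y hy
        (det_Fm_ne N _ (h1 y hy))).contDiffWithinAt
      rw [Fm_eq_Gm N hN _ (h1 y hy), h2 y hy]
    · exact hinj (h1 _ (hmaps hp)) hp (h2 _ (hmaps hp))
  · intro p hp
    have hd := ((hcd p hp).differentiableAt (by norm_num)).hasFDerivAt
    have hG := ((contDiff_Gm N).differentiable (by norm_num) (specRolled N hN0 p)).hasFDerivAt
    have hcomp := hG.comp p hd
    have hF : HasFDerivAt (Fm N) ((fderiv ℝ (Gm N) (specRolled N hN0 p)).comp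
        (fderiv ℝ (specRolled N hN0) p)) p := by
      refine hcomp.congr_of_eventuallyEq ?_
      filter_upwards [(isOpen_dom N).mem_nhds hp] with q hq
      exact Fm_eq_Gm N hN q hq
    have hdet : |LinearMap.det (fderiv ℝ (Fm N) p).toLinearMap| =
        |LinearMap.det (fderiv ℝ (Gm N) (specRolled N hN0 p)).toLinearMap| *
          |LinearMap.det (fderiv ℝ (specRolled N hN0) p).toLinearMap| := by
      rw [hF.fderiv, ← abs_mul, ← LinearMap.det_comp]
      rfl
    have hne := det_Gm_ne N hN _ (hmaps hp)
    have hbp : ∀ k, k < N → 0 < bet (qOf N p) k := fun k hk => bet_pos N p hp k hk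
    have hprodb : bet (qOf N p) (N - 1) = ∏ i : Fin (N - 1), wPart p i := by
      rw [bet, ← Fin.prod_univ_eq_prod_range (fun h => qOf N p (2 * h + 1))]
      exact Finset.prod_congr rfl fun i _ => qOf_odd N p i i.2
    have hh := prod_half (bet (qOf N p)) N (by omega)
    rw [hank_spec N hN0 p hp, hprodb] at hh
    rw [← abs_pos] at hne
    rw [det_Gm N (by omega), xPart_spec, wExt_spec N hN p hp] at hne hdet
    rw [det_Fm] at hdet
    have hWp : 0 < ∏ n : Fin N, jacobiWeights hN0 (xPart p) (wPart p) n :=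
      Finset.prod_pos fun n _ => (spec_mem N hN p hp).1 n
    have hwp : 0 < ∏ i : Fin (N - 1), wPart p i := Finset.prod_pos fun i _ => hp i
    rw [abs_of_pos (Finset.prod_pos fun i hi => hbp _ (by simp at hi; omega)),
      abs_of_nonneg (mul_nonneg hWp.le (sq_nonneg _))] at hdet
    rw [abs_of_nonneg (mul_nonneg hWp.le (sq_nonneg _))] at hne
    rw [Finset.prod_inv_distrib]
    generalize (∏ n : Fin N, jacobiWeights hN0 (xPart p) (wPart p) n) = P at *
    generalize (∏ i : Fin (N - 1), wPart p i) = B at *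
    rw [hdet] at hh
    have hgoal : |LinearMap.det (fderiv ℝ (specRolled N hN0) p).toLinearMap| * B = P := by
      apply mul_left_cancel₀ hne.ne'
      linear_combination hh
    rw [eq_inv_mul_iff_mul_eq₀ hwp.ne', mul_comm]
    exact hgoal
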